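/- arXiv:1901.04418 — 6 statements merged into one kernel-verified Lean document; each statement's English description precedes it below -/
import Mathlib

section
/- Let 0 < η < 1/2 and let p/q be a rational number. Then the set D_{p/q}(η) = (p/q − η, p/q + η) ∩ DC₁(η², 3) has positive Lebesgue measure; indeed its Lebesgue measure is at least 2η(1 − 2η). -/
open MeasureTheory

/-- `DC₁(γ, σ)` (with exponent `σ = 3`): the set of `α ∈ ℝ` such that
`|α − k/l| ≥ γ/l³` for all `k ∈ ℤ` and all `l ∈ ℕ*`. -/
def DCone (γ : ℝ) : Set ℝ :=
  {α : ℝ | ∀ (k : ℤ) (l : ℕ), 0 < l → γ / (l : ℝ) ^ 3 ≤ |α - (k : ℝ) / (l : ℝ)|}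

/-- `D_{p/q}(η) = (p/q − η, p/q + η) ∩ DC₁(η², 3)`. -/
def Dpq (p : ℤ) (q : ℕ) (η : ℝ) : Set ℝ :=
  Set.Ioo ((p : ℝ) / (q : ℝ) - η) ((p : ℝ) / (q : ℝ) + η) ∩ DCone (η ^ 2)

/-- The points of the circle `ℝ / ℤ` within `γ / l ^ 3` of a fraction `j / l`, for some `l`. -/
def circleResonances (γ : ℝ) : Set UnitAddCircle :=
  ⋃ l : ℕ, ⋃ j ∈ Finset.range l,
    Metric.closedBall (((j : ℝ) / (l : ℝ) : ℝ) : UnitAddCircle) (γ / (l : ℝ) ^ 3)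

theorem measurableSet_circleResonances (γ : ℝ) : MeasurableSet (circleResonances γ) :=
  MeasurableSet.iUnion fun _ => Finset.measurableSet_biUnion _ fun _ _ =>
    Metric.isClosed_closedBall.measurableSet

theorem coe_int_div_eq_coe_emod_div (k : ℤ) {l : ℕ} (hl : 0 < l) :
    (((k : ℝ) / (l : ℝ) : ℝ) : UnitAddCircle)
      = ((((k % (l : ℤ)).toNat : ℝ) / (l : ℝ) : ℝ) : UnitAddCircle) := by
  have hl' : (l : ℝ) ≠ 0 := by positivity
  have hcast : (((k % (l : ℤ)).toNat : ℕ) : ℝ) = ((k % (l : ℤ) : ℤ) : ℝ) := by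
    exact_mod_cast Int.toNat_of_nonneg (Int.emod_nonneg k (by omega))
  have hk : (k : ℝ) = ((k % (l : ℤ) : ℤ) : ℝ) + (l : ℝ) * ((k / (l : ℤ) : ℤ) : ℝ) := by
    exact_mod_cast (Int.emod_add_mul_ediv k l).symm
  rw [hcast, ← sub_eq_zero, ← AddCircle.coe_sub, AddCircle.coe_eq_zero_iff]
  refine ⟨k / (l : ℤ), ?_⟩
  rw [zsmul_eq_mul, mul_one, ← sub_div, eq_div_iff hl', hk]
  simp
  ring

theorem coe_mem_circleResonances_of_notMem_DCone {γ α : ℝ} (hα : α ∉ DCone γ) :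
    (α : UnitAddCircle) ∈ circleResonances γ := by
  simp only [DCone, Set.mem_ofPred_eq, not_forall, not_le] at hα
  obtain ⟨k, l, hl, h⟩ := hα
  have hmod : (k % (l : ℤ)).toNat < l := by
    have := Int.emod_lt_of_pos k (b := l) (by omega)
    omega
  simp only [circleResonances, Set.mem_iUnion]
  refine ⟨l, (k % (l : ℤ)).toNat, Finset.mem_range.2 hmod, ?_⟩
  rw [Metric.mem_closedBall, ← coe_int_div_eq_coe_emod_div k hl, dist_eq_norm,
    ← AddCircle.coe_sub]
  exact (QuotientAddGroup.norm_mk_le_norm).trans h.le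

theorem volume_circleResonances_le {γ : ℝ} (hγ : 0 ≤ γ) :
    volume (circleResonances γ) ≤ ENNReal.ofReal (4 * γ) := by
  have hterm (l : ℕ) : volume (⋃ j ∈ Finset.range l,
      Metric.closedBall (((j : ℝ) / (l : ℝ) : ℝ) : UnitAddCircle) (γ / (l : ℝ) ^ 3))
        ≤ ENNReal.ofReal (2 * γ * (1 / (l : ℝ) ^ 2)) := by
    refine (measure_biUnion_finset_le _ _).trans ?_
    calc _ ≤ ∑ _j ∈ Finset.range l, ENNReal.ofReal (2 * (γ / (l : ℝ) ^ 3)) := by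
          refine Finset.sum_le_sum fun j _ => ?_
          rw [AddCircle.volume_closedBall]
          exact ENNReal.ofReal_le_ofReal (min_le_right _ _)
      _ = ENNReal.ofReal (2 * γ * (1 / (l : ℝ) ^ 2)) := by
          rw [Finset.sum_const, Finset.card_range, nsmul_eq_mul, ← ENNReal.ofReal_natCast,
            ← ENNReal.ofReal_mul (by positivity)]
          congr 1
          rcases Nat.eq_zero_or_pos l with rfl | hl
          · simp
          · field_simp
  have hsum := hasSum_zeta_two.mul_left (2 * γ)
  calc volume (circleResonances γ)
      ≤ ∑' l : ℕ, ENNReal.ofReal (2 * γ * (1 / (l : ℝ) ^ 2)) :=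
        (measure_iUnion_le _).trans (ENNReal.tsum_le_tsum hterm)
    _ = ENNReal.ofReal (2 * γ * (Real.pi ^ 2 / 6)) := by
        rw [← ENNReal.ofReal_tsum_of_nonneg (fun l => by positivity) hsum.summable,
          hsum.tsum_eq]
    _ ≤ ENNReal.ofReal (4 * γ) := by
        refine ENNReal.ofReal_le_ofReal ?_
        have hpi : Real.pi ^ 2 / 6 ≤ 2 := by nlinarith [Real.pi_lt_d2, Real.pi_pos]
        nlinarith

/-- For `0 < η < 1/2`, the set `D_{p/q}(η)` has Lebesgue measure at least
`2η(1 − 2η)`; in particular it has positive Lebesgue measure. -/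
theorem stmt_0 (η : ℝ) (hη0 : 0 < η) (hη1 : η < 1 / 2) (p : ℤ) (q : ℕ) (hq : 0 < q) :
    ENNReal.ofReal (2 * η * (1 - 2 * η)) ≤ volume (Dpq p q η) ∧
      0 < volume (Dpq p q η) := by
  have hle : ENNReal.ofReal (2 * η * (1 - 2 * η)) ≤ volume (Dpq p q η) := by
    set c : ℝ := (p : ℝ) / (q : ℝ)
    have hpres := UnitAddCircle.measurePreserving_mk (c - η)
    have hbad : volume (Set.Ioo (c - η) (c + η) \ DCone (η ^ 2))
        ≤ ENNReal.ofReal (4 * η ^ 2) := by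
      refine le_trans ?_ (volume_circleResonances_le (sq_nonneg η))
      rw [← hpres.measure_preimage (measurableSet_circleResonances _).nullMeasurableSet,
        Measure.restrict_apply (hpres.measurable (measurableSet_circleResonances _))]
      refine measure_mono fun α hα => ⟨coe_mem_circleResonances_of_notMem_DCone hα.2, hα.1.1, ?_⟩
      linarith [hα.1.2]
    have hsplit := measure_le_inter_add_sdiff volume (Set.Ioo (c - η) (c + η)) (DCone (η ^ 2))
    rw [Real.volume_Ioo] at hsplit
    calc ENNReal.ofReal (2 * η * (1 - 2 * η))
        = ENNReal.ofReal (c + η - (c - η)) - ENNReal.ofReal (4 * η ^ 2) := by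
          rw [← ENNReal.ofReal_sub _ (by positivity)]
          congr 1
          ring
      _ ≤ volume (Dpq p q η) :=
          tsub_le_iff_right.2 (hsplit.trans (add_le_add le_rfl hbad))
  refine ⟨hle, lt_of_lt_of_le (ENNReal.ofReal_pos.2 ?_) hle⟩
  exact mul_pos (by linarith) (by linarith)
end

section
/- Let I and J be two intervals of ℝ and f : I → J a continuous map. Assume there exists a set M ⊆ f(I) of positive Lebesgue measure such that for every x ∈ f⁻¹(M) there is a constant C_x > 0 with |f(x) − f(x')| ≤ C_x |x − x'| for all x' ∈ I sufficiently close to x. Then f⁻¹(M) has positive Lebesgue measure. -/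
open MeasureTheory

/-- A Lipschitz function on a Lebesgue-null subset of `ℝ` has Lebesgue-null image. -/
theorem LipschitzOnWith.volume_image_eq_zero {K : NNReal} {f : ℝ → ℝ} {s : Set ℝ}
    (hf : LipschitzOnWith K f s) (hs : volume s = 0) : volume (f '' s) = 0 := by
  have h := hf.hausdorffMeasure_image_le (d := 1) zero_le_one
  rw [hausdorffMeasure_real, hs, mul_zero] at h
  exact le_antisymm h zero_le

/-- A function that is pointwise Lipschitz at every point of a Lebesgue-null subset of `ℝ`,
with constants depending on the point, maps this set to a Lebesgue-null set. -/
theorem volume_image_eq_zero_of_pointwise_lipschitz {f : ℝ → ℝ} {s : Set ℝ}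
    (hs : volume s = 0)
    (hf : ∀ x ∈ s, ∃ C : ℝ, ∃ δ > (0 : ℝ),
      ∀ y ∈ s, |x - y| < δ → |f x - f y| ≤ C * |x - y|) :
    volume (f '' s) = 0 := by
  let t : ℕ × ℤ → Set ℝ := fun p =>
    {x ∈ s | (∀ y ∈ s, |x - y| < 1 / ((p.1 : ℝ) + 1) → |f x - f y| ≤ p.1 * |x - y|) ∧
      ⌊x * ((p.1 : ℝ) + 1)⌋ = p.2}
  have hcover : s ⊆ ⋃ p, t p := by
    intro x hx
    obtain ⟨C, δ, hδ, h⟩ := hf x hx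
    obtain ⟨m, hm⟩ := exists_nat_ge C
    obtain ⟨k, hk⟩ := exists_nat_one_div_lt hδ
    refine Set.mem_iUnion.2 ⟨(max m k, ⌊x * (((max m k : ℕ) : ℝ) + 1)⌋), hx, ?_, rfl⟩
    intro y hy hxy
    have hmC : C ≤ ((max m k : ℕ) : ℝ) := hm.trans (by exact_mod_cast le_max_left m k)
    have hkδ : 1 / (((max m k : ℕ) : ℝ) + 1) ≤ 1 / ((k : ℝ) + 1) := by
      gcongr
      exact le_max_right m k
    exact (h y hy (hxy.trans_le (hkδ.trans hk.le))).trans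
      (mul_le_mul_of_nonneg_right hmC (abs_nonneg _))
  have hnull : ∀ p, volume (f '' t p) = 0 := by
    intro p
    have hlip : LipschitzOnWith p.1 f (t p) := by
      refine LipschitzOnWith.of_dist_le_mul fun x hx y hy => ?_
      have hpos : (0 : ℝ) < (p.1 : ℝ) + 1 := by positivity
      have h := Int.abs_sub_lt_one_of_floor_eq_floor (hx.2.2.trans hy.2.2.symm)
      rw [← sub_mul, abs_mul, abs_of_pos hpos] at h
      simpa [Real.dist_eq] using hx.2.1 y hy.1 ((lt_div_iff₀ hpos).2 h)
    exact hlip.volume_image_eq_zero (measure_mono_null (fun x hx => hx.1) hs)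
  refine measure_mono_null (Set.image_mono hcover) ?_
  rw [Set.image_iUnion]
  exact measure_iUnion_null hnull

/-- Let `I` and `J` be two intervals of `ℝ` and `f : I → J` a continuous map.  If
`M ⊆ f(I)` has positive Lebesgue measure and for every `x ∈ f⁻¹(M) ∩ I` there is a
constant `C_x > 0` with `|f(x) − f(x')| ≤ C_x |x − x'|` for all `x' ∈ I` sufficiently
close to `x`, then `f⁻¹(M) ∩ I` has positive Lebesgue measure. -/
theorem stmt_1 (I J M : Set ℝ) (hI : I.OrdConnected) (hJ : J.OrdConnected)
    (f : ℝ → ℝ) (hf : ContinuousOn f I) (hfIJ : Set.MapsTo f I J)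
    (hMI : M ⊆ f '' I) (hM : 0 < volume M)
    (hLip : ∀ x ∈ I ∩ f ⁻¹' M, ∃ C > (0 : ℝ), ∃ δ > (0 : ℝ),
      ∀ x' ∈ I, |x - x'| < δ → |f x - f x'| ≤ C * |x - x'|) :
    0 < volume (I ∩ f ⁻¹' M) := by
  refine pos_iff_ne_zero.2 fun h0 => hM.ne' ?_
  refine measure_mono_null (t := f '' (I ∩ f ⁻¹' M)) ?_
    (volume_image_eq_zero_of_pointwise_lipschitz h0 fun x hx => ?_)
  · intro y hy
    obtain ⟨x, hx, rfl⟩ := hMI hy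
    exact ⟨x, ⟨hx, hy⟩, rfl⟩
  · obtain ⟨C, -, δ, hδ, h⟩ := hLip x hx
    exact ⟨C, δ, hδ, fun y hy => h y hy.1⟩
end

section
/- Let p/q ∈ ℚ and let A : 𝕋 → SL(2,ℝ) be a smooth map, homotopic to the identity, such that |tr(A(x + (q−1)p/q)···A(x + p/q)A(x))| < 2 for all x ∈ 𝕋. Then there exist smooth maps B : 𝕋 → SL(2,ℝ) and φ : 𝕋 → ℝ such that B(x + p/q)⁻¹ A(x) B(x) = R_{φ(x)} for all x ∈ 𝕋, where R_φ denotes the rotation matrix [[cos φ, −sin φ], [sin φ, cos φ]]. -/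
open Matrix MeasureTheory
open scoped ENNReal

attribute [local instance] Matrix.normedAddCommGroup Matrix.normedSpace

/-- The rotation matrix `R_φ = [[cos φ, −sin φ], [sin φ, cos φ]] ∈ SO(2,ℝ)`. -/
noncomputable def Rot (φ : ℝ) : Matrix (Fin 2) (Fin 2) ℝ :=
  !![Real.cos φ, -Real.sin φ; Real.sin φ, Real.cos φ]

/-- A (1-periodic) map `A : 𝕋 → SL(2,ℝ)` is homotopic to the identity:  there is a
continuous homotopy, through 1-periodic maps with values in `SL(2,ℝ)`, from `A` to the
constant map `x ↦ Id`. -/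
def HomotopicToId (A : ℝ → Matrix (Fin 2) (Fin 2) ℝ) : Prop :=
  ∃ H : ℝ → ℝ → Matrix (Fin 2) (Fin 2) ℝ,
    Continuous (fun st : ℝ × ℝ => H st.1 st.2) ∧
    (∀ t x, (H t x).det = 1) ∧
    (∀ t x, H t (x + 1) = H t x) ∧
    (∀ x, H 0 x = A x) ∧ (∀ x, H 1 x = 1)

/-- The fibered product `A(x+(n−1)α) ⋯ A(x+α) A(x)` of the cocycle `(α, A)`. -/
noncomputable def fiberProd (α : ℝ) (A : ℝ → Matrix (Fin 2) (Fin 2) ℝ) (n : ℕ) (x : ℝ) :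
    Matrix (Fin 2) (Fin 2) ℝ :=
  ((List.range n).reverse.map fun k => A (x + (k : ℝ) * α)).prod

/-- The unit vector of direction `2πy`. -/
noncomputable def dirVec (y : ℝ) : Fin 2 → ℝ :=
  ![Real.cos (2 * Real.pi * y), Real.sin (2 * Real.pi * y)]

/-- `F : ℝ → ℝ → ℝ` is a lift of the projective dynamics induced by the (1-periodic,
homotopic to the identity) map `A : 𝕋 → SL(2,ℝ)` on `𝕋 × 𝕊¹`. -/
def IsProjLift (A : ℝ → Matrix (Fin 2) (Fin 2) ℝ) (F : ℝ → ℝ → ℝ) : Prop :=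
  Continuous (fun xy : ℝ × ℝ => F xy.1 xy.2) ∧
  (∀ x y, F (x + 1) y = F x y) ∧
  (∀ x y, F x (y + 1) = F x y + 1) ∧
  (∀ x y, ∃ c : ℝ, 0 < c ∧ (A x).mulVec (dirVec y) = c • dirVec (F x y))

/-- Iterates of a lift of the projective cocycle `(α, A)`:  the second coordinate of
the `n`-th iterate of `(x,y) ↦ (x+α, F(x,y))`. -/
noncomputable def liftIter (α : ℝ) (F : ℝ → ℝ → ℝ) : ℕ → ℝ → ℝ → ℝ
  | 0, _, y => y
  | n + 1, x, y => F (x + (n : ℝ) * α) (liftIter α F n x y)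

/-- `ρ` is (a representative of) the fibered rotation number of the cocycle `(α, A)`,
for irrational `α`. -/
def IsFiberedRotNum (α : ℝ) (A : ℝ → Matrix (Fin 2) (Fin 2) ℝ) (ρ : ℝ) : Prop :=
  ∃ F : ℝ → ℝ → ℝ, IsProjLift A F ∧
    Filter.Tendsto (fun n : ℕ => liftIter α F n 0 0 / (n : ℝ)) Filter.atTop (nhds ρ)

/-- The fibered rotation number of the cocycle `(p/q, A)` at rational frequency,
computed from a lift `F` of the projective dynamics:
`ρ(p/q, A) = (1/q) ∫_𝕋 rot((f̃^q)_x) dx`. -/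
noncomputable def ratRot (p : ℤ) (q : ℕ) (F : ℝ → ℝ → ℝ) : ℝ :=
  ∫ x in (0:ℝ)..1,
    Filter.limsup
      (fun n : ℕ => liftIter ((p : ℝ) / (q : ℝ)) F (q * (n + 1)) x 0 / ((q : ℝ) * ((n : ℝ) + 1)))
      Filter.atTop

/-! ### Periodic lifts through the exponential map -/

/-- A loop of nonzero complex numbers that is freely homotopic to the constant loop `1`
has a continuous periodic logarithm. -/
theorem exists_periodic_log {v : ℝ × ℝ → ℂ} (hv : Continuous v) (h0 : ∀ z, v z ≠ 0)
    (hper : ∀ t x, v (t, x + 1) = v (t, x)) (h1 : ∀ x, v (1, x) = 1) :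
    ∃ g : ℝ → ℂ, Continuous g ∧ (∀ x, g (x + 1) = g x) ∧ ∀ x, Complex.exp (g x) = v (0, x) := by
  obtain ⟨G, ⟨hG0, hG⟩, hGu⟩ := Complex.isCoveringMapOn_exp.existsUnique_continuousMap_lifts
    (⟨v, hv⟩ : C(ℝ × ℝ, ℂ)) (a₀ := ((1 : ℝ), (0 : ℝ))) (e₀ := 0) (by simp [h1])
    (fun z => by simpa using h0 z)
  have hexp : ∀ z, Complex.exp (G z) = v z := fun z => congrFun hG z
  have hone : G (1, 1) = 0 := by
    have hu := (Complex.isCoveringMapOn_exp.existsUnique_continuousMap_lifts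
      (ContinuousMap.const ℝ (1 : ℂ)) (a₀ := 0) (e₀ := 0) (by simp) (fun z => by simp)).unique
      (y₁ := ⟨fun x : ℝ => G (1, x), by fun_prop⟩) (y₂ := ContinuousMap.const ℝ 0)
      ⟨hG0, funext fun x => by simp [hexp, h1]⟩ ⟨rfl, funext fun x => by simp⟩
    simpa using DFunLike.congr_fun hu 1
  have hshift := hGu ⟨fun z : ℝ × ℝ => G (z.1, z.2 + 1), by fun_prop⟩
    ⟨by simpa using hone, funext fun z => by simp [hexp, hper]⟩
  exact ⟨fun x => G (0, x), by fun_prop, fun x => DFunLike.congr_fun hshift (0, x),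
    fun x => hexp (0, x)⟩

/-- A continuous angle is as smooth as its cosine and sine. -/
theorem contDiff_of_contDiff_cos_sin {φ : ℝ → ℝ} {n : WithTop ℕ∞} (hφ : Continuous φ)
    (hc : ContDiff ℝ n fun x => Real.cos (φ x)) (hs : ContDiff ℝ n fun x => Real.sin (φ x)) :
    ContDiff ℝ n φ := by
  rw [contDiff_iff_contDiffAt]
  intro x₀
  have hsub : ContDiff ℝ n fun x => Real.sin (φ x - φ x₀) := by
    simp only [Real.sin_sub]
    exact (hs.mul contDiff_const).sub (hc.mul contDiff_const)
  have harc : ContDiffAt ℝ n (fun x => φ x₀ + Real.arcsin (Real.sin (φ x - φ x₀))) x₀ :=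
    contDiffAt_const.add <| ContDiffAt.comp (g := Real.arcsin) x₀
      (Real.contDiffAt_arcsin (by simp) (by simp)) hsub.contDiffAt
  refine harc.congr_of_eventuallyEq ?_
  have hnear : ∀ᶠ x in nhds x₀, φ x - φ x₀ ∈ Set.Ioo (-(Real.pi / 2)) (Real.pi / 2) :=
    (hφ.sub continuous_const).continuousAt.eventually_mem
      (Ioo_mem_nhds (by simp [Real.pi_pos]) (by simp [Real.pi_pos]))
  filter_upwards [hnear] with x hx
  rw [Real.arcsin_sin hx.1.le hx.2.le]
  ring

/-- A smooth unit vector field `(u, v)` has a smooth periodic angle as soon as, up to a factor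
avoiding the nonpositive reals, it has a continuous periodic logarithm. -/
theorem exists_contDiff_periodic_angle {u v : ℝ → ℝ} {n : WithTop ℕ∞} (hu : ContDiff ℝ n u)
    (hv : ContDiff ℝ n v) (huv : ∀ x, u x ^ 2 + v x ^ 2 = 1) {g r : ℝ → ℂ} (hg : Continuous g)
    (hr : Continuous r) (hgper : ∀ x, g (x + 1) = g x) (hrper : ∀ x, r (x + 1) = r x)
    (hslit : ∀ x, r x ∈ Complex.slitPlane)
    (h : ∀ x, (u x : ℂ) + v x * Complex.I = r x * Complex.exp (g x)) :
    ∃ φ : ℝ → ℝ, ContDiff ℝ n φ ∧ (∀ x, φ (x + 1) = φ x) ∧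
      ∀ x, Real.cos (φ x) = u x ∧ Real.sin (φ x) = v x := by
  set L : ℝ → ℂ := fun x => Complex.log (r x) + g x with hL
  have hexp : ∀ x, Complex.exp (L x) = u x + v x * Complex.I := fun x => by
    rw [hL, Complex.exp_add, Complex.exp_log (Complex.slitPlane_ne_zero (hslit x)), h]
  have hre : ∀ x, Real.exp (L x).re = 1 := fun x => by
    rw [← Complex.norm_exp, hexp, Complex.norm_add_mul_I, huv, Real.sqrt_one]
  have hcs : ∀ x, Real.cos (L x).im = u x ∧ Real.sin (L x).im = v x := fun x => by
    have e1 := congrArg Complex.re (hexp x)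
    have e2 := congrArg Complex.im (hexp x)
    rw [Complex.exp_re, hre] at e1
    rw [Complex.exp_im, hre] at e2
    exact ⟨by simpa using e1, by simpa using e2⟩
  have hcont : Continuous fun x => (L x).im :=
    Complex.continuous_im.comp ((hr.clog hslit).add hg)
  refine ⟨fun x => (L x).im, contDiff_of_contDiff_cos_sin hcont ?_ ?_, fun x => ?_, hcs⟩
  · simpa only [(hcs _).1] using hu
  · simpa only [(hcs _).2] using hv
  · simp only [hL, hgper, hrper]

/-! ### Iterates of a cocycle -/

theorem fiberProd_zero (α : ℝ) (A : ℝ → Matrix (Fin 2) (Fin 2) ℝ) (x : ℝ) :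
    fiberProd α A 0 x = 1 := by
  simp [fiberProd]

theorem fiberProd_succ (α : ℝ) (A : ℝ → Matrix (Fin 2) (Fin 2) ℝ) (n : ℕ) (x : ℝ) :
    fiberProd α A (n + 1) x = A (x + n * α) * fiberProd α A n x := by
  simp [fiberProd, List.range_succ]

theorem fiberProd_succ' (α : ℝ) (A : ℝ → Matrix (Fin 2) (Fin 2) ℝ) (n : ℕ) (x : ℝ) :
    fiberProd α A (n + 1) x = fiberProd α A n (x + α) * A x := by
  induction n with
  | zero => simp [fiberProd]
  | succ n ih =>
    rw [fiberProd_succ, ih, fiberProd_succ α A n (x + α), Matrix.mul_assoc]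
    congr 2
    push_cast
    ring

theorem fiberProd_det {A : ℝ → Matrix (Fin 2) (Fin 2) ℝ} (hdet : ∀ x, (A x).det = 1) (α : ℝ)
    (n : ℕ) (x : ℝ) : (fiberProd α A n x).det = 1 := by
  induction n with
  | zero => simp [fiberProd_zero]
  | succ n ih => rw [fiberProd_succ, Matrix.det_mul, ih, hdet, one_mul]

theorem fiberProd_add_one {A : ℝ → Matrix (Fin 2) (Fin 2) ℝ} (hper : ∀ x, A (x + 1) = A x)
    (α : ℝ) (n : ℕ) (x : ℝ) : fiberProd α A n (x + 1) = fiberProd α A n x := by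
  simp only [fiberProd, add_right_comm x 1, hper]

theorem contDiff_matrix_iff {M : ℝ → Matrix (Fin 2) (Fin 2) ℝ} {n : WithTop ℕ∞} :
    ContDiff ℝ n M ↔ ∀ i j, ContDiff ℝ n fun x => M x i j :=
  contDiff_pi.trans (forall_congr' fun _ => contDiff_pi)

theorem contDiff_fiberProd {A : ℝ → Matrix (Fin 2) (Fin 2) ℝ} {m : WithTop ℕ∞}
    (hA : ContDiff ℝ m A) (α : ℝ) (n : ℕ) : ContDiff ℝ m (fiberProd α A n) := by
  induction n with
  | zero => simpa only [funext (fiberProd_zero α A)] using contDiff_const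
  | succ n ih =>
    rw [contDiff_matrix_iff] at ih ⊢
    intro i j
    simp only [fiberProd_succ, Matrix.mul_apply, Fin.sum_univ_two]
    have hshift : ∀ k, ContDiff ℝ m fun x => A (x + n * α) i k := fun k =>
      (contDiff_matrix_iff.1 hA i k).comp (contDiff_id.add contDiff_const)
    exact ((hshift 0).mul (ih 0 j)).add ((hshift 1).mul (ih 1 j))

/-- Over a rational frequency `p / q`, the `q`-th iterate is conjugated to its translate. -/
theorem fiberProd_shift_mul {A : ℝ → Matrix (Fin 2) (Fin 2) ℝ} (hper : ∀ x, A (x + 1) = A x)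
    (p : ℤ) {q : ℕ} (hq : 0 < q) (x : ℝ) :
    fiberProd ((p : ℝ) / q) A q (x + (p : ℝ) / q) * A x
      = A x * fiberProd ((p : ℝ) / q) A q x := by
  have hq' : (q : ℝ) ≠ 0 := by positivity
  rw [← fiberProd_succ', fiberProd_succ, mul_div_cancel₀ _ hq']
  congr 1
  simpa using (show Function.Periodic A 1 from hper).int_mul p x

/-! ### Normalization of elliptic matrices -/

/-- A smooth family of elliptic matrices in `SL(2,ℝ)` yields a smooth family of complex
structures, of the form `κ(tr M) (M - (tr M / 2) Id)`, with positive lower left entry. -/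
theorem exists_complex_structure {M : ℝ → Matrix (Fin 2) (Fin 2) ℝ} {n : WithTop ℕ∞}
    (hM : ContDiff ℝ n M) (hdet : ∀ x, (M x).det = 1) (hell : ∀ x, |(M x).trace| < 2) :
    ∃ κ : ℝ → ℝ, ∀ N : ℝ → Matrix (Fin 2) (Fin 2) ℝ,
      (∀ x, N x = κ (M x).trace • (M x - ((M x).trace / 2) • (1 : Matrix (Fin 2) (Fin 2) ℝ))) →
      ContDiff ℝ n N ∧ (∀ x, 0 < N x 1 0) ∧ (∀ x, N x 1 1 = -N x 0 0) ∧
        ∀ x, N x 0 0 ^ 2 + N x 0 1 * N x 1 0 = -1 := by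
  have hentry := contDiff_matrix_iff.1 hM
  have hpos : ∀ x, 0 < 1 - (M x).trace ^ 2 / 4 := fun x => by
    have := sq_lt_sq' (neg_lt_of_abs_lt (hell x)) (lt_of_abs_lt (hell x))
    linarith
  have hne : ∀ x, M x 1 0 ≠ 0 := fun x h => by
    have hd := hdet x
    have hp := hpos x
    rw [Matrix.trace_fin_two] at hp
    rw [Matrix.det_fin_two, h] at hd
    nlinarith [sq_nonneg (M x 0 0 - M x 1 1)]
  obtain ⟨ε, hε, hεpos⟩ : ∃ ε : ℝ, ε ^ 2 = 1 ∧ ∀ x, 0 < ε * M x 1 0 := by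
    have hcont := (hentry 1 0).continuous
    have hIVT : ∀ x y, M x 1 0 < 0 → 0 < M y 1 0 → False := fun x y hx hy => by
      obtain ⟨z, hz⟩ := mem_range_of_exists_le_of_exists_ge hcont ⟨x, hx.le⟩ ⟨y, hy.le⟩
      exact hne z hz
    rcases lt_or_gt_of_ne (hne 0) with h | h
    · refine ⟨-1, by norm_num, fun x => ?_⟩
      rcases lt_or_gt_of_ne (hne x) with h' | h'
      · linarith
      · exact (hIVT 0 x h h').elim
    · refine ⟨1, by norm_num, fun x => ?_⟩
      rcases lt_or_gt_of_ne (hne x) with h' | h'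
      · exact (hIVT x 0 h' h).elim
      · linarith
  refine ⟨fun t => ε / √(1 - t ^ 2 / 4), fun N hN => ?_⟩
  have hsq : ∀ x, 0 < √(1 - (M x).trace ^ 2 / 4) := fun x => Real.sqrt_pos.2 (hpos x)
  refine ⟨?_, fun x => ?_, fun x => ?_, fun x => ?_⟩
  · have htr : ContDiff ℝ n fun x => (M x).trace := by
      simp only [Matrix.trace_fin_two]
      exact (hentry 0 0).add (hentry 1 1)
    have hκ : ContDiff ℝ n fun x => ε / √(1 - (M x).trace ^ 2 / 4) :=
      contDiff_const.div
        ((contDiff_const.sub ((htr.pow 2).div_const 4)).sqrt fun x => (hpos x).ne')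
        fun x => (hsq x).ne'
    rw [contDiff_matrix_iff]
    intro i j
    simp only [hN, Matrix.smul_apply, Matrix.sub_apply, smul_eq_mul]
    exact hκ.mul ((hentry i j).sub ((htr.div_const 2).mul contDiff_const))
  · rw [hN]
    have := div_pos (hεpos x) (hsq x)
    simpa [div_mul_eq_mul_div] using this
  · rw [hN]
    simp [Matrix.trace_fin_two]
    ring
  · have hs := Real.sq_sqrt (hpos x).le
    have hd := hdet x
    have hs0 := (hsq x).ne'
    rw [hN]
    simp only [Matrix.smul_apply, Matrix.sub_apply, smul_eq_mul, Matrix.one_apply]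
    norm_num
    set s := √(1 - (M x).trace ^ 2 / 4)
    rw [Matrix.trace_fin_two] at *
    rw [Matrix.det_fin_two] at hd
    field_simp
    rw [hε, hs]
    linear_combination (-4) * hd

/-- The upper triangular matrix of determinant one conjugating the standard complex structure
to the one with upper left entry `m` and lower left entry `w ^ 2`. -/
noncomputable def triConj (w m : ℝ) : Matrix (Fin 2) (Fin 2) ℝ :=
  !![w⁻¹, m * w⁻¹; 0, w]

theorem triConj_det {w : ℝ} (hw : 0 < w) (m : ℝ) : (triConj w m).det = 1 := by
  simp [triConj, Matrix.det_fin_two, hw.ne']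

theorem triConj_inv {w : ℝ} (hw : 0 < w) (m : ℝ) :
    (triConj w m)⁻¹ = !![w, -(m * w⁻¹); 0, w⁻¹] := by
  rw [Matrix.inv_def, triConj_det hw]
  simp [triConj, Matrix.adjugate_fin_two]

/-- A matrix of determinant one intertwining two complex structures becomes a rotation in
adapted triangular frames. -/
theorem triConj_inv_mul_mul_eq {w m w' m' : ℝ} {A N N' : Matrix (Fin 2) (Fin 2) ℝ} (hw : 0 < w)
    (hw' : 0 < w') (hN : N = triConj w m * !![0, -1; 1, 0] * (triConj w m)⁻¹)
    (hN' : N' = triConj w' m' * !![0, -1; 1, 0] * (triConj w' m')⁻¹) (hA : A.det = 1)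
    (h : N' * A = A * N) {U : Matrix (Fin 2) (Fin 2) ℝ}
    (hU : U = (triConj w' m')⁻¹ * A * triConj w m) :
    U = !![U 0 0, -U 1 0; U 1 0, U 0 0] ∧ U 0 0 ^ 2 + U 1 0 ^ 2 = 1 := by
  have hB : IsUnit (triConj w m).det := by simp [triConj_det hw]
  have hB' : IsUnit (triConj w' m').det := by simp [triConj_det hw']
  have hcomm : !![0, -1; 1, 0] * U = U * !![0, -1; 1, 0] := by
    calc !![0, -1; 1, 0] * U
        = (triConj w' m')⁻¹ * (N' * A) * triConj w m := by
          rw [hN', hU]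
          simp only [Matrix.mul_assoc, Matrix.nonsing_inv_mul_cancel_left _ _ hB']
      _ = U * !![0, -1; 1, 0] := by
          rw [h, hN, hU]
          simp only [Matrix.mul_assoc, Matrix.nonsing_inv_mul _ hB, Matrix.mul_one]
  have e1 : -U 1 0 = U 0 1 := by
    simpa [Matrix.mul_apply, Fin.sum_univ_two] using congrFun (congrFun hcomm 0) 0
  have e2 : U 0 0 = U 1 1 := by
    simpa [Matrix.mul_apply, Fin.sum_univ_two] using congrFun (congrFun hcomm 1) 0
  have hdet : U.det = 1 := by
    rw [hU, Matrix.det_mul, Matrix.det_mul, Matrix.det_nonsing_inv, triConj_det hw,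
      triConj_det hw', hA]
    simp
  refine ⟨?_, ?_⟩
  · ext i j
    fin_cases i <;> fin_cases j <;> simp [e1, ← e2]
  · rw [Matrix.det_fin_two, ← e1, ← e2] at hdet
    linear_combination hdet

theorem eq_triConj_mul_mul_inv {N : Matrix (Fin 2) (Fin 2) ℝ} (hpos : 0 < N 1 0)
    (htr : N 1 1 = -N 0 0) (hdet : N 0 0 ^ 2 + N 0 1 * N 1 0 = -1) :
    N = triConj (√(N 1 0)) (N 0 0) * !![0, -1; 1, 0] * (triConj (√(N 1 0)) (N 0 0))⁻¹ := by
  have hw := Real.sqrt_pos.2 hpos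
  have hsq := Real.sq_sqrt hpos.le
  rw [triConj_inv hw]
  set w := √(N 1 0)
  have h01 : N 0 1 = -(1 + N 0 0 ^ 2) / w ^ 2 := by
    rw [hsq]
    field_simp
    linear_combination hdet
  ext i j
  fin_cases i <;> fin_cases j <;> simp [triConj, htr, h01]
  · field_simp
  · field_simp
  · linear_combination -hsq
  · field_simp

/-- The ratio of a vector and its image under an upper triangular matrix with positive diagonal
avoids the nonpositive reals. -/
theorem upper_triangular_div_mem_slitPlane {s t : ℝ} (hs : 0 < s) (ht : 0 < t) (k a c : ℝ)
    (h : (a : ℂ) + c * Complex.I ≠ 0) :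
    (((s * a + k * c : ℝ) : ℂ) + ((t * c : ℝ) : ℂ) * Complex.I) / (a + c * Complex.I)
      ∈ Complex.slitPlane := by
  set r := (((s * a + k * c : ℝ) : ℂ) + ((t * c : ℝ) : ℂ) * Complex.I) / (a + c * Complex.I)
    with hr
  rw [Complex.mem_slitPlane_iff]
  by_cases him : r.im = 0
  · left
    rw [eq_div_iff h] at hr
    have e1 := congrArg Complex.re hr
    have e2 := congrArg Complex.im hr
    simp [him] at e1 e2
    by_cases hc : c = 0
    · have ha : a ≠ 0 := fun ha => h (by simp [ha, hc])
      have : r.re = s := mul_right_cancel₀ ha (by simpa [hc] using e1)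
      rwa [this]
    · rcases e2 with e2 | e2
      · rwa [e2]
      · exact absurd e2 hc
  · exact Or.inr him

/-- Periodic approximation: if `A : 𝕋 → SL(2,ℝ)` is smooth, homotopic to the identity,
and `|tr(A(x+(q−1)p/q)⋯A(x))| < 2` for all `x`, then there are smooth maps
`B : 𝕋 → SL(2,ℝ)` and `φ : 𝕋 → ℝ` with `B(x+p/q)⁻¹ A(x) B(x) = R_{φ(x)}`. -/
theorem stmt_2 (p : ℤ) (q : ℕ) (hq : 0 < q) (A : ℝ → Matrix (Fin 2) (Fin 2) ℝ)
    (hA : ContDiff ℝ (⊤ : ℕ∞) A) (hper : ∀ x, A (x + 1) = A x) (hdet : ∀ x, (A x).det = 1)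
    (hhom : HomotopicToId A)
    (hell : ∀ x, |(fiberProd ((p : ℝ) / (q : ℝ)) A q x).trace| < 2) :
    ∃ (B : ℝ → Matrix (Fin 2) (Fin 2) ℝ) (φ : ℝ → ℝ),
      ContDiff ℝ (⊤ : ℕ∞) B ∧ ContDiff ℝ (⊤ : ℕ∞) φ ∧
      (∀ x, B (x + 1) = B x) ∧ (∀ x, φ (x + 1) = φ x) ∧
      (∀ x, (B x).det = 1) ∧
      ∀ x, (B (x + (p : ℝ) / (q : ℝ)))⁻¹ * A x * B x = Rot (φ x) := by
  obtain ⟨H, hHc, hHdet, hHper, hH0, hH1⟩ := hhom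
  have hHne : ∀ z : ℝ × ℝ, (H z.1 z.2 0 0 : ℂ) + H z.1 z.2 1 0 * Complex.I ≠ 0 := fun z h => by
    have e1 := congrArg Complex.re h
    have e2 := congrArg Complex.im h
    simp at e1 e2
    simpa [Matrix.det_fin_two, e1, e2] using hHdet z.1 z.2
  have hHentry : ∀ i j, Continuous fun z : ℝ × ℝ => H z.1 z.2 i j :=
    fun i j => hHc.matrix_elem i j
  obtain ⟨g, hgc, hgper, hg⟩ := exists_periodic_log
    (v := fun z => (H z.1 z.2 0 0 : ℂ) + H z.1 z.2 1 0 * Complex.I)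
    ((Complex.continuous_ofReal.comp (hHentry 0 0)).add
      ((Complex.continuous_ofReal.comp (hHentry 1 0)).mul continuous_const)) hHne
    (fun t x => by simp only [hHper]) (fun x => by simp [hH1])
  simp only [hH0] at hg
  set α : ℝ := (p : ℝ) / q
  set M := fiberProd α A q with hM
  have hMA : ∀ x, M (x + α) * A x = A x * M x := fiberProd_shift_mul hper p hq
  have hMtr : ∀ x, (M (x + α)).trace = (M x).trace := fun x => by
    have hu : IsUnit (A x).det := by simp [hdet]
    rw [← Matrix.mul_nonsing_inv_cancel_right _ (M (x + α)) hu, hMA, Matrix.mul_assoc,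
      Matrix.trace_mul_comm, Matrix.mul_assoc, Matrix.nonsing_inv_mul _ hu, Matrix.mul_one]
  obtain ⟨κ, hκ⟩ := exists_complex_structure (contDiff_fiberProd hA α q)
    (fiberProd_det hdet α q) hell
  set N : ℝ → Matrix (Fin 2) (Fin 2) ℝ := fun x =>
    κ (M x).trace • (M x - ((M x).trace / 2) • (1 : Matrix (Fin 2) (Fin 2) ℝ)) with hN
  obtain ⟨hNc, hNpos, hNtr, hNdet⟩ := hκ N fun x => rfl
  have hNA : ∀ x, N (x + α) * A x = A x * N x := fun x => by
    simp only [hN, hMtr, Matrix.smul_mul, Matrix.mul_smul, Matrix.sub_mul, Matrix.mul_sub, hMA,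
      Matrix.one_mul, Matrix.mul_one]
  have hNper : ∀ x, N (x + 1) = N x := fun x => by
    simp only [hN, hM, fiberProd_add_one hper]
  have hNentry := contDiff_matrix_iff.1 hNc
  set w : ℝ → ℝ := fun x => √(N x 1 0) with hw
  have hwpos : ∀ x, 0 < w x := fun x => Real.sqrt_pos.2 (hNpos x)
  have hwc : ContDiff ℝ (⊤ : ℕ∞) w := (hNentry 1 0).sqrt fun x => (hNpos x).ne'
  have hwinv : ContDiff ℝ (⊤ : ℕ∞) fun x => (w x)⁻¹ := hwc.inv fun x => (hwpos x).ne'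
  set B : ℝ → Matrix (Fin 2) (Fin 2) ℝ := fun x => triConj (w x) (N x 0 0) with hB
  have hBper : ∀ x, B (x + 1) = B x := fun x => by simp only [hB, hw, hNper]
  have hBc : ContDiff ℝ (⊤ : ℕ∞) B := by
    rw [contDiff_matrix_iff]
    intro i j
    fin_cases i <;> fin_cases j
    · exact hwinv
    · exact (hNentry 0 0).mul hwinv
    · exact contDiff_const
    · exact hwc
  set U : ℝ → Matrix (Fin 2) (Fin 2) ℝ := fun x => (B (x + α))⁻¹ * A x * B x with hU
  have hUrot := fun x => triConj_inv_mul_mul_eq (hwpos x) (hwpos (x + α))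
    (eq_triConj_mul_mul_inv (hNpos x) (hNtr x) (hNdet x))
    (eq_triConj_mul_mul_inv (hNpos (x + α)) (hNtr (x + α)) (hNdet (x + α))) (hdet x) (hNA x)
    (U := U x) rfl
  have hUper : ∀ x, U (x + 1) = U x := fun x => by
    simp only [hU, add_right_comm x 1 α, hBper, hper]
  have hU0 : ∀ x, U x 0 0 = w (x + α) * (w x)⁻¹ * A x 0 0
      + -(N (x + α) 0 0 * (w (x + α))⁻¹) * (w x)⁻¹ * A x 1 0 := fun x => by
    simp only [hU, hB, triConj_inv (hwpos _)]
    simp [triConj, Matrix.mul_apply, Matrix.vecMul, dotProduct, Fin.sum_univ_two]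
    ring
  have hU1 : ∀ x, U x 1 0 = (w (x + α))⁻¹ * (w x)⁻¹ * A x 1 0 := fun x => by
    simp only [hU, hB, triConj_inv (hwpos _)]
    simp [triConj, Matrix.mul_apply, Matrix.vecMul, dotProduct, Fin.sum_univ_two]
    ring
  have hshift : ContDiff ℝ (⊤ : ℕ∞) fun x : ℝ => x + α := contDiff_id.add contDiff_const
  have hAentry := contDiff_matrix_iff.1 hA
  have hU1c : ContDiff ℝ (⊤ : ℕ∞) fun x => U x 1 0 := by
    simp only [hU1]
    exact ((hwinv.comp hshift).mul hwinv).mul (hAentry 1 0)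
  have hU0c : ContDiff ℝ (⊤ : ℕ∞) fun x => U x 0 0 := by
    simp only [hU0]
    exact (((hwc.comp hshift).mul hwinv).mul (hAentry 0 0)).add
      (((((hNentry 0 0).comp hshift).mul (hwinv.comp hshift)).neg.mul hwinv).mul (hAentry 1 0))
  have hAne : ∀ x, (A x 0 0 : ℂ) + A x 1 0 * Complex.I ≠ 0 := fun x => by
    rw [← hg]
    exact Complex.exp_ne_zero _
  obtain ⟨φ, hφc, hφper, hφ⟩ := exists_contDiff_periodic_angle hU0c hU1c (fun x => (hUrot x).2)
    (r := fun x => ((U x 0 0 : ℂ) + U x 1 0 * Complex.I) / (A x 0 0 + A x 1 0 * Complex.I)) hgc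
    (Continuous.div
      ((Complex.continuous_ofReal.comp hU0c.continuous).add
        ((Complex.continuous_ofReal.comp hU1c.continuous).mul continuous_const))
      ((Complex.continuous_ofReal.comp (hAentry 0 0).continuous).add
        ((Complex.continuous_ofReal.comp (hAentry 1 0).continuous).mul continuous_const)) hAne)
    hgper (fun x => by simp only [hUper, hper])
    (fun x => by
      simp only [hU0, hU1]
      exact upper_triangular_div_mem_slitPlane
        (mul_pos (hwpos _) (inv_pos.2 (hwpos x)))
        (mul_pos (inv_pos.2 (hwpos _)) (inv_pos.2 (hwpos x))) _ _ _ (hAne x))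
    (fun x => by rw [hg, div_mul_cancel₀ _ (hAne x)])
  refine ⟨B, φ, hBc, hφc, hBper, hφper, fun x => triConj_det (hwpos x) _, fun x => ?_⟩
  rw [Rot, (hφ x).1, (hφ x).2]
  exact (hUrot x).1
end

section
/- Let (p,q) ∈ ℤ × ℕ* with p∧q = 1, and let V : 𝕋 → ℝ be a nonnegative smooth function with support contained in (0, 1/q). For x ∈ [j/q, (j+1)/q] let x̃ denote the point of the orbit {x + kp/q mod 1 : 0 ≤ k ≤ q−1} lying in [0, 1/q], and let A_E^{(q)}(x) = S_{E−V}(x+(q−1)p/q)···S_{E−V}(x). Then: if E = 2cos θ, tr(A_E^{(q)}(x)) = −V(x̃)·sin(qθ)/sin θ + 2cos(qθ); and if E = 2cosh θ, tr(A_E^{(q)}(x)) = −V(x̃)·sinh(qθ)/sinh θ + 2cosh(qθ). -/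
open Matrix MeasureTheory
open scoped ENNReal

attribute [local instance] Matrix.normedAddCommGroup Matrix.normedSpace

/-- The Schrödinger matrix `S_W = [[W, −1], [1, 0]] ∈ SL(2,ℝ)`. -/
noncomputable def Smat (w : ℝ) : Matrix (Fin 2) (Fin 2) ℝ := !![w, -1; 1, 0]

/-- The (upper) Lyapunov exponent
`LE(α, A) = lim_n (1/n) ∫_𝕋 log ‖A(x+(n−1)α) ⋯ A(x)‖ dx`. -/
noncomputable def lyap (α : ℝ) (A : ℝ → Matrix (Fin 2) (Fin 2) ℝ) : ℝ :=
  Filter.limsup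
    (fun n : ℕ => (n : ℝ)⁻¹ * ∫ x in (0:ℝ)..1, Real.log ‖fiberProd α A n x‖)
    Filter.atTop

/-- The powers of the free Schrödinger matrix are given by Chebyshev polynomials of the
second kind. -/
theorem Smat_pow_eq_chebyshev (c : ℝ) (n : ℕ) :
    Smat (2 * c) ^ n =
      !![(Polynomial.Chebyshev.U ℝ n).eval c, -(Polynomial.Chebyshev.U ℝ (n - 1)).eval c;
        (Polynomial.Chebyshev.U ℝ (n - 1)).eval c,
        -(Polynomial.Chebyshev.U ℝ (n - 2)).eval c] := by
  induction n with
  | zero => simp [Matrix.one_fin_two]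
  | succ n ih =>
    have h₁ : (Polynomial.Chebyshev.U ℝ (n + 1)).eval c =
        2 * c * (Polynomial.Chebyshev.U ℝ n).eval c -
          (Polynomial.Chebyshev.U ℝ (n - 1)).eval c := by
      simp [Polynomial.Chebyshev.U_add_one]
    have h₂ : (Polynomial.Chebyshev.U ℝ n).eval c =
        2 * c * (Polynomial.Chebyshev.U ℝ (n - 1)).eval c -
          (Polynomial.Chebyshev.U ℝ (n - 2)).eval c := by
      simp [Polynomial.Chebyshev.U_eq ℝ n]
    have e₁ : ((n + 1 : ℕ) : ℤ) - 1 = n := by push_cast; ring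
    have e₂ : ((n + 1 : ℕ) : ℤ) - 2 = n - 1 := by push_cast; ring
    rw [e₁, e₂, pow_succ', ih, Smat, Matrix.mul_fin_two, Nat.cast_succ, h₁]
    ext i j
    fin_cases i <;> fin_cases j <;> simp <;> linarith

theorem fiberProd_eq_pow {α : ℝ} {A : ℝ → Matrix (Fin 2) (Fin 2) ℝ}
    {B : Matrix (Fin 2) (Fin 2) ℝ} {n : ℕ} {x : ℝ}
    (h : ∀ k < n, A (x + k * α) = B) : fiberProd α A n x = B ^ n := by
  induction n with
  | zero => simp [fiberProd]
  | succ n ih =>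
    rw [fiberProd_succ, ih fun k hk => h k (hk.trans n.lt_succ_self), h n n.lt_succ_self,
      pow_succ']

/-- A fibered product all of whose factors but one equal `B`. -/
theorem fiberProd_eq_pow_mul_mul_pow {α : ℝ} {A : ℝ → Matrix (Fin 2) (Fin 2) ℝ}
    {B : Matrix (Fin 2) (Fin 2) ℝ} {k j : ℕ} {x : ℝ}
    (h : ∀ i < k + 1 + j, i ≠ k → A (x + i * α) = B) :
    fiberProd α A (k + 1 + j) x = B ^ j * (A (x + k * α) * B ^ k) := by
  induction j with
  | zero =>
    rw [add_zero, fiberProd_succ, fiberProd_eq_pow fun i hi => h i (by omega) (by omega),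
      pow_zero, one_mul]
  | succ j ih =>
    rw [← add_assoc, fiberProd_succ, ih fun i hi => h i (by omega),
      h (k + 1 + j) (by omega) (by omega), pow_succ', mul_assoc]

/-- The trace of a fibered product of Schrödinger matrices with potential vanishing at every
orbit point but one. -/
theorem trace_fiberProd_of_single {α c x : ℝ} {V : ℝ → ℝ} {n k : ℕ} (hk : k < n)
    (h : ∀ i < n, i ≠ k → V (x + i * α) = 0) :
    (fiberProd α (fun t => Smat (2 * c - V t)) n x).trace =
      -V (x + k * α) * (Polynomial.Chebyshev.U ℝ ((n : ℤ) - 1)).eval c +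
        2 * (Polynomial.Chebyshev.T ℝ n).eval c := by
  obtain ⟨j, rfl⟩ := Nat.exists_eq_add_of_lt hk
  rw [add_right_comm] at h ⊢
  have hU : 2 * (Polynomial.Chebyshev.T ℝ (k + 1 + j : ℕ)).eval c =
      2 * (c * (Polynomial.Chebyshev.U ℝ (k + j : ℕ)).eval c) -
        2 * (Polynomial.Chebyshev.U ℝ ((k + j : ℕ) - 1)).eval c := by
    have h₁ := congrArg (Polynomial.eval c)
      (Polynomial.Chebyshev.T_eq_X_mul_U_sub_U ℝ ((k + j : ℕ) - 1))
    have e₁ : ((k + j : ℕ) : ℤ) - 1 + 2 = (k + 1 + j : ℕ) := by push_cast; ring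
    rw [e₁] at h₁
    simp only [Polynomial.eval_sub, Polynomial.eval_mul, Polynomial.eval_X,
      sub_add_cancel] at h₁
    linarith
  have e₂ : ((k + 1 + j : ℕ) : ℤ) - 1 = (k + j : ℕ) := by push_cast; ring
  rw [fiberProd_eq_pow_mul_mul_pow (B := Smat (2 * c))
      fun i hi hik => by simp only [h i hi hik, sub_zero],
    Matrix.trace_mul_comm, mul_assoc, ← pow_add, Smat_pow_eq_chebyshev, Smat,
    Matrix.mul_fin_two, Matrix.trace_fin_two_of, e₂, hU]
  ring

/-- A `1`-periodic function supported in `(0, 1/q)` modulo `1` vanishes at the points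
`y + d/q` with `y ∈ [0, 1/q]` and `d` not divisible by `q`. -/
theorem eq_zero_of_not_dvd {q : ℕ} (hq : 0 < q) {V : ℝ → ℝ} (hVper : Function.Periodic V 1)
    (hVsupp : ∀ y ∈ Set.Icc (0 : ℝ) 1, V y ≠ 0 → y ∈ Set.Ioo 0 (1 / (q : ℝ)))
    {y : ℝ} (hy : y ∈ Set.Icc (0 : ℝ) (1 / (q : ℝ))) {d : ℤ} (hd : ¬ (q : ℤ) ∣ d) :
    V (y + d / q) = 0 := by
  have hq' : (0 : ℝ) < q := by exact_mod_cast hq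
  have hpos : 1 ≤ d % q := by
    have := Int.emod_nonneg d (b := q) (by omega)
    have : d % q ≠ 0 := fun h0 => hd (Int.dvd_of_emod_eq_zero h0)
    omega
  have hlt : d % q + 1 ≤ q := Int.emod_lt_of_pos d (by omega)
  have hdiv : (d : ℝ) = (d % q : ℤ) + q * (d / q : ℤ) := by
    exact_mod_cast (Int.emod_add_mul_ediv d q).symm
  have hy' : y + d / q = y + (d % q : ℤ) / q + (d / q : ℤ) * 1 := by
    field_simp
    linarith
  rw [hy', hVper.int_mul]
  have h₁ : 1 / (q : ℝ) ≤ (d % q : ℤ) / q := by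
    gcongr; exact_mod_cast hpos
  have h₂ : ((d % q : ℤ) : ℝ) / q + 1 / q ≤ 1 := by
    rw [← add_div, div_le_one hq']; exact_mod_cast hlt
  by_contra hne
  have := hVsupp _ ⟨by linarith [hy.1, one_div_pos.2 hq'], by linarith [hy.2]⟩ hne
  linarith [this.2, hy.1]

/-- Computation of the trace of `(p/q, S_{E−V})^q` for a potential `V ≥ 0` supported in
`(0, 1/q)`.  If `x̃` is the point of the orbit `{x + k p/q mod 1}` lying in `[0, 1/q]`,
then for `E = 2cos θ`, `tr A_E^{(q)}(x) = −V(x̃)·sin(qθ)/sin θ + 2cos(qθ)`, and for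
`E = 2cosh θ`, `tr A_E^{(q)}(x) = −V(x̃)·sinh(qθ)/sinh θ + 2cosh(qθ)`, where
`sin(qθ)/sin θ` and `sinh(qθ)/sinh θ` are interpreted as the Chebyshev values
`U_{q−1}(cos θ)` and `U_{q−1}(cosh θ)`. -/
theorem stmt_13 (p : ℤ) (q : ℕ) (hq : 0 < q) (hpq : Int.gcd p (q : ℤ) = 1)
    (V : ℝ → ℝ) (hVsm : ContDiff ℝ (⊤ : ℕ∞) V) (hVper : ∀ x, V (x + 1) = V x)
    (hVpos : ∀ x, 0 ≤ V x)
    (hVsupp : ∀ y ∈ Set.Icc (0:ℝ) 1, V y ≠ 0 → y ∈ Set.Ioo 0 (1 / (q : ℝ)))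
    (E θ x xt : ℝ)
    (hxt_orbit : ∃ k < q, ∃ m : ℤ, xt = x + (k : ℝ) * ((p : ℝ) / (q : ℝ)) + (m : ℝ))
    (hxt_mem : xt ∈ Set.Icc (0 : ℝ) (1 / (q : ℝ))) :
    (E = 2 * Real.cos θ →
      (fiberProd ((p : ℝ) / (q : ℝ)) (fun t => Smat (E - V t)) q x).trace =
        -V xt * (Polynomial.Chebyshev.U ℝ ((q : ℤ) - 1)).eval (Real.cos θ) +
          2 * Real.cos ((q : ℝ) * θ)) ∧
    (E = 2 * Real.cosh θ →
      (fiberProd ((p : ℝ) / (q : ℝ)) (fun t => Smat (E - V t)) q x).trace =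
        -V xt * (Polynomial.Chebyshev.U ℝ ((q : ℤ) - 1)).eval (Real.cosh θ) +
          2 * Real.cosh ((q : ℝ) * θ)) := by
  obtain ⟨k, hk, m, hkm⟩ := hxt_orbit
  have hVper' : Function.Periodic V 1 := hVper
  have hq' : (q : ℝ) ≠ 0 := by exact_mod_cast hq.ne'
  have hVxt : V xt = V (x + k * (p / q)) := by
    rw [hkm, ← mul_one (m : ℝ), hVper'.int_mul]
  have hzero : ∀ i < q, i ≠ k → V (x + i * (p / q)) = 0 := by
    intro i hi hik
    have hd : ¬ (q : ℤ) ∣ ((i : ℤ) - k) * p := by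
      intro hdvd
      have hcop : IsCoprime (q : ℤ) p := (Int.isCoprime_iff_gcd_eq_one.2 hpq).symm
      have hzero := Int.eq_zero_of_abs_lt_dvd (hcop.dvd_of_dvd_mul_right hdvd)
        (abs_lt.2 ⟨by omega, by omega⟩)
      omega
    have hx : x + i * (p / q) = xt + (((i : ℤ) - k) * p : ℤ) / q - m * 1 := by
      rw [hkm]; push_cast; field_simp; ring
    rw [hx, hVper'.sub_int_mul_eq, eq_zero_of_not_dvd hq hVper' hVsupp hxt_mem hd]
  constructor <;> rintro rfl <;> rw [trace_fiberProd_of_single hk hzero, hVxt]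
  · rw [Polynomial.Chebyshev.T_real_cos, Int.cast_natCast]
  · rw [Polynomial.Chebyshev.T_real_cosh, Int.cast_natCast]
end

section
/- Let K, λ > 0 and V_{K,λ}(x) = K/(1 + 4λ sin²(πx)). Then for every ε > 0 there is λ_pp = λ_pp(ε) > 0 such that for all λ > λ_pp and all irrational α, LE(α, S_{E−V_{K,λ}}) > 0 for all E with |E| > 2 + ε. Moreover, for all λ > 0, all irrational α, and all E with |E| > 2, one has the lower bound LE(α, S_{E−V_{K,λ}}) ≥ log(z₀·(|E| + √(E²−4))/2), where z₀ = (2λ + 1 − √(4λ+1))/(2λ). -/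
open Matrix MeasureTheory
open scoped ENNReal

attribute [local instance] Matrix.normedAddCommGroup Matrix.normedSpace

/-- The potential `V_{K,λ}(x) = K / (1 + 4λ sin²(πx))`. -/
noncomputable def Vkl (K lam x : ℝ) : ℝ := K / (1 + 4 * lam * Real.sin (Real.pi * x) ^ 2)

open Complex in
/-- The first column of the product `M(ω^{n-1} w) ⋯ M(ω w) M(w)`, where `ω = exp(2πiα)` and
`M = [[F, -D], [D, 0]]`. -/
noncomputable def columnIter (F D : ℂ → ℂ) (α : ℝ) : ℕ → ℂ → ℂ × ℂ
  | 0, _ => (1, 0)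
  | n + 1, w =>
    (F (exp (2 * Real.pi * (n * α) * I) * w) * (columnIter F D α n w).1 -
        D (exp (2 * Real.pi * (n * α) * I) * w) * (columnIter F D α n w).2,
      D (exp (2 * Real.pi * (n * α) * I) * w) * (columnIter F D α n w).1)

theorem continuous_fiberProd (α : ℝ) {A : ℝ → Matrix (Fin 2) (Fin 2) ℝ} (hA : Continuous A)
    (n : ℕ) : Continuous (fiberProd α A n) := by
  induction n with
  | zero => exact continuous_const.congr fun x => (fiberProd_zero α A x).symm
  | succ n ih =>
    exact ((hA.comp (by fun_prop)).matrix_mul ih).congr fun x => (fiberProd_succ α A n x).symm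

theorem det_fiberProd (α : ℝ) {A : ℝ → Matrix (Fin 2) (Fin 2) ℝ} (hA : ∀ x, (A x).det = 1)
    (n : ℕ) (x : ℝ) : (fiberProd α A n x).det = 1 := by
  induction n with
  | zero => simp [fiberProd_zero]
  | succ n ih => rw [fiberProd_succ, det_mul, hA, ih, one_mul]

theorem norm_mul_le_two_mul (A B : Matrix (Fin 2) (Fin 2) ℝ) : ‖A * B‖ ≤ 2 * ‖A‖ * ‖B‖ := by
  refine (Matrix.norm_le_iff (by positivity)).2 fun i j => ?_
  have h : ∀ k, ‖A i k * B k j‖ ≤ ‖A‖ * ‖B‖ := fun k => by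
    rw [norm_mul]
    exact mul_le_mul (norm_entry_le_entrywise_sup_norm A) (norm_entry_le_entrywise_sup_norm B)
      (norm_nonneg _) (norm_nonneg _)
  rw [Matrix.mul_apply, Fin.sum_univ_two]
  linarith [norm_add_le (A i 0 * B 0 j) (A i 1 * B 1 j), h 0, h 1]

theorem half_le_norm_of_det_eq_one {A : Matrix (Fin 2) (Fin 2) ℝ} (hA : A.det = 1) :
    1 / 2 ≤ ‖A‖ := by
  by_contra! h
  have h' : ∀ i j, |A i j| ≤ 1 / 2 := fun i j =>
    (norm_entry_le_entrywise_sup_norm A).trans h.le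
  rw [det_fin_two] at hA
  have h1 := mul_le_mul (h' 0 0) (h' 1 1) (abs_nonneg _) (by norm_num)
  have h2 := mul_le_mul (h' 0 1) (h' 1 0) (abs_nonneg _) (by norm_num)
  rw [← abs_mul] at h1 h2
  linarith [le_abs_self (A 0 0 * A 1 1), neg_abs_le (A 0 1 * A 1 0)]

theorem norm_fiberProd_le (α : ℝ) {A : ℝ → Matrix (Fin 2) (Fin 2) ℝ} {C : ℝ}
    (hA : ∀ x, ‖A x‖ ≤ C) (n : ℕ) (x : ℝ) : ‖fiberProd α A n x‖ ≤ (2 * C) ^ n := by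
  have hC : 0 ≤ C := (norm_nonneg _).trans (hA 0)
  induction n with
  | zero =>
    rw [fiberProd_zero, pow_zero]
    refine (Matrix.norm_le_iff zero_le_one).2 fun i j => ?_
    fin_cases i <;> fin_cases j <;> simp
  | succ n ih =>
    rw [fiberProd_succ, pow_succ']
    refine (norm_mul_le_two_mul _ _).trans ?_
    gcongr
    exact hA _

theorem intervalIntegrable_log_norm_fiberProd (α : ℝ) {A : ℝ → Matrix (Fin 2) (Fin 2) ℝ}
    (hA : Continuous A) (hdet : ∀ x, (A x).det = 1) (n : ℕ) :
    IntervalIntegrable (fun x => Real.log ‖fiberProd α A n x‖) volume 0 1 := by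
  refine Continuous.intervalIntegrable (Continuous.log ?_ fun x => ?_) _ _
  · exact (continuous_fiberProd α hA n).norm
  · linarith [half_le_norm_of_det_eq_one (det_fiberProd α hdet n x)]

theorem isBoundedUnder_log_norm_fiberProd (α : ℝ) {A : ℝ → Matrix (Fin 2) (Fin 2) ℝ} {C : ℝ}
    (hA : Continuous A) (hdet : ∀ x, (A x).det = 1) (hC : ∀ x, ‖A x‖ ≤ C) :
    Filter.atTop.IsBoundedUnder (· ≤ ·)
      (fun n : ℕ => (n : ℝ)⁻¹ * ∫ x in (0:ℝ)..1, Real.log ‖fiberProd α A n x‖) := by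
  refine Filter.isBoundedUnder_of_eventually_le (a := Real.log (2 * C)) ?_
  filter_upwards [Filter.eventually_gt_atTop 0] with n hn
  have hn' : (0 : ℝ) < n := by exact_mod_cast hn
  have h : ∫ x in (0:ℝ)..1, Real.log ‖fiberProd α A n x‖ ≤
      ∫ _ in (0:ℝ)..1, n * Real.log (2 * C) := by
    refine intervalIntegral.integral_mono_on zero_le_one
      (intervalIntegrable_log_norm_fiberProd α hA hdet n) (by simp) fun x _ => ?_
    rw [← Real.log_pow]
    refine Real.log_le_log ?_ (norm_fiberProd_le α hC n x)
    linarith [half_le_norm_of_det_eq_one (det_fiberProd α hdet n x)]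
  rw [intervalIntegral.integral_const, sub_zero, one_smul] at h
  rwa [inv_mul_le_iff₀ hn']

open Metric in
theorem log_norm_le_circleAverage {f : ℂ → ℂ} (hf : AnalyticOnNhd ℂ f (closedBall 0 1))
    (h0 : f 0 ≠ 0) : Real.log ‖f 0‖ ≤ Real.circleAverage (Real.log ‖f ·‖) 0 1 := by
  have hf' : AnalyticOnNhd ℂ f (closedBall 0 |1|) := by simpa using hf
  rw [AnalyticOnNhd.circleAverage_log_norm one_ne_zero hf' h0]
  refine le_add_of_nonneg_left (finsum_nonneg fun u => ?_)
  have hd : 0 ≤ MeromorphicOn.divisor f (closedBall 0 |1|) u := MeromorphicOn.AnalyticOnNhd.divisor_nonneg hf' u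
  by_cases hu : u ∈ closedBall (0 : ℂ) |1|
  · refine mul_nonneg (by exact_mod_cast hd) ?_
    rcases eq_or_ne u 0 with rfl | hu0
    · simp
    · refine Real.log_nonneg ?_
      rw [one_mul, zero_sub, norm_neg]
      exact (one_le_inv₀ (norm_pos_iff.2 hu0)).2 (by simpa using hu)
  · simp [Function.locallyFinsuppWithin.apply_eq_zero_of_notMem _ hu]

open Complex in
theorem circleAverage_eq_integral_exp (g : ℂ → ℝ) :
    Real.circleAverage g 0 1 = ∫ x in (0:ℝ)..1, g (exp (2 * Real.pi * x * I)) := by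
  have h := intervalIntegral.integral_comp_mul_left (a := 0) (b := 1)
    (fun θ => g (circleMap 0 1 θ)) Real.two_pi_pos.ne'
  rw [mul_zero, mul_one] at h
  rw [Real.circleAverage_def, ← h]
  simp [circleMap]

open Complex in
theorem intervalIntegrable_exp_of_circleIntegrable {g : ℂ → ℝ} (hg : CircleIntegrable g 0 1) :
    IntervalIntegrable (fun x : ℝ => g (exp (2 * Real.pi * x * I))) volume 0 1 := by
  have h := IntervalIntegrable.comp_mul_left (c := 2 * Real.pi) hg
  rw [zero_div, div_self Real.two_pi_pos.ne'] at h
  simpa [circleMap] using h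

open Metric Complex in
theorem analyticOnNhd_columnIter {F D : ℂ → ℂ} (hF : AnalyticOnNhd ℂ F (closedBall 0 1))
    (hD : AnalyticOnNhd ℂ D (closedBall 0 1)) (α : ℝ) (n : ℕ) :
    AnalyticOnNhd ℂ (fun w => (columnIter F D α n w).1) (closedBall 0 1) ∧
      AnalyticOnNhd ℂ (fun w => (columnIter F D α n w).2) (closedBall 0 1) := by
  induction n with
  | zero => exact ⟨analyticOnNhd_const, analyticOnNhd_const⟩
  | succ n ih =>
    have hrot : AnalyticOnNhd ℂ (fun w => exp (2 * Real.pi * (n * α) * I) * w)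
        (closedBall 0 1) := analyticOnNhd_const.mul analyticOnNhd_id
    have hmaps : Set.MapsTo (fun w => exp (2 * Real.pi * (n * α) * I) * w)
        (closedBall 0 1) (closedBall 0 1) := fun w hw => by
      have h : ‖exp (2 * Real.pi * (n * α) * I)‖ = 1 := by
        have := norm_exp_ofReal_mul_I (2 * Real.pi * (n * α))
        push_cast at this
        exact this
      simpa [h] using hw
    have hF' := hF.comp hrot hmaps
    have hD' := hD.comp hrot hmaps
    exact ⟨(hF'.mul ih.1).sub (hD'.mul ih.2), hD'.mul ih.1⟩

open Complex in
theorem columnIter_exp {F D : ℂ → ℂ} {W : ℝ → ℝ}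
    (hW : ∀ x : ℝ, F (exp (2 * Real.pi * x * I)) = D (exp (2 * Real.pi * x * I)) * W x)
    (hD : ∀ x : ℝ, ‖D (exp (2 * Real.pi * x * I))‖ = 1) (α : ℝ) (n : ℕ) (x : ℝ) :
    ∃ d : ℂ, ‖d‖ = 1 ∧ columnIter F D α n (exp (2 * Real.pi * x * I)) =
      (d * fiberProd α (fun x => Smat (W x)) n x 0 0,
        d * fiberProd α (fun x => Smat (W x)) n x 1 0) := by
  induction n with
  | zero => exact ⟨1, by simp, by simp [columnIter, fiberProd_zero]⟩
  | succ n ih =>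
    obtain ⟨d, hd, h⟩ := ih
    have hrot : exp (2 * Real.pi * (n * α) * I) * exp (2 * Real.pi * x * I) =
        exp (2 * Real.pi * (x + n * α : ℝ) * I) := by
      rw [← exp_add]
      congr 1
      push_cast
      ring
    refine ⟨D (exp (2 * Real.pi * (x + n * α : ℝ) * I)) * d, by rw [norm_mul, hD, hd, one_mul],
      ?_⟩
    rw [columnIter, h, hrot, hW, fiberProd_succ]
    refine Prod.ext ?_ ?_
    · simp [Matrix.mul_apply, Smat]
      ring
    · simp [Matrix.mul_apply, Smat]
      ring

theorem le_norm_columnIter_zero {F D : ℂ → ℂ} {E m z : ℝ} (hm : 0 < m) (hE : |E| = m + 1 / m)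
    (hD : ‖D 0‖ = z) (hF : F 0 = D 0 * E) (α : ℝ) (n : ℕ) :
    (z * m) ^ n ≤ ‖(columnIter F D α n 0).1‖ ∧
      m * ‖(columnIter F D α n 0).2‖ ≤ ‖(columnIter F D α n 0).1‖ := by
  have hz : 0 ≤ z := hD ▸ norm_nonneg _
  induction n with
  | zero => simp [columnIter]
  | succ n ih =>
    simp only [columnIter, mul_zero, hF]
    set p := (columnIter F D α n 0).1
    set r := (columnIter F D α n 0).2
    have hr : ‖r‖ ≤ 1 / m * ‖p‖ := by
      rw [one_div, inv_mul_eq_div, le_div_iff₀ hm, mul_comm]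
      exact ih.2
    have hsub : m * ‖p‖ ≤ ‖(E : ℂ) * p - r‖ := by
      have h := norm_sub_norm_le ((E : ℂ) * p) r
      rw [norm_mul, Complex.norm_real, Real.norm_eq_abs, hE] at h
      linarith
    have hstep : z * m * ‖p‖ ≤ ‖D 0 * E * p - D 0 * r‖ := by
      rw [mul_assoc (D 0), ← mul_sub, norm_mul, hD, mul_assoc]
      gcongr
    refine ⟨?_, ?_⟩
    · rw [pow_succ']
      refine le_trans ?_ hstep
      gcongr
      exact ih.1
    · rw [norm_mul, hD]
      linarith

open Metric Complex in
/-- Herman's subharmonicity bound: if `W` becomes, after multiplication by a function `D` analytic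
on the closed disk and unimodular on its boundary, the boundary value of an analytic function `F`,
then the Lyapunov exponent of the Schrödinger cocycle is at least that of the constant matrix
`[[F 0, -D 0], [D 0, 0]]`. -/
theorem log_le_lyap {F D : ℂ → ℂ} {W : ℝ → ℝ} {E m z C : ℝ} (hWc : Continuous W)
    (hWb : ∀ x, |W x| ≤ C)
    (hFa : AnalyticOnNhd ℂ F (closedBall 0 1)) (hDa : AnalyticOnNhd ℂ D (closedBall 0 1))
    (hW : ∀ x : ℝ, F (exp (2 * Real.pi * x * I)) = D (exp (2 * Real.pi * x * I)) * W x)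
    (hD : ∀ x : ℝ, ‖D (exp (2 * Real.pi * x * I))‖ = 1)
    (hz : 0 < z) (hm : 0 < m) (hE : |E| = m + 1 / m)
    (hD0 : ‖D 0‖ = z) (hF0 : F 0 = D 0 * E) (α : ℝ) :
    Real.log (z * m) ≤ lyap α (fun x => Smat (W x)) := by
  have hA : Continuous fun x => Smat (W x) := by
    refine continuous_matrix fun i j => ?_
    fin_cases i <;> fin_cases j <;> simp [Smat] <;> fun_prop
  have hdet : ∀ x, (Smat (W x)).det = 1 := fun x => by simp [Smat, det_fin_two]
  have hnorm : ∀ x, ‖Smat (W x)‖ ≤ C + 1 := fun x => by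
    have h := hWb x
    have h0 := abs_nonneg (W x)
    refine (Matrix.norm_le_iff (by linarith)).2 fun i j => ?_
    fin_cases i <;> fin_cases j <;> simp [Smat] <;> linarith
  have hbdd := isBoundedUnder_log_norm_fiberProd α hA hdet hnorm
  have key : ∀ n : ℕ, n * Real.log (z * m) - Real.log 2 ≤
      ∫ x in (0:ℝ)..1, Real.log ‖fiberProd α (fun x => Smat (W x)) n x‖ := fun n => by
    have han := (analyticOnNhd_columnIter hFa hDa α n).1
    have hlow := (le_norm_columnIter_zero hm hE hD0 hF0 α n).1
    have hpos : 0 < (z * m) ^ n := by positivity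
    have hint : IntervalIntegrable
        (fun x : ℝ => Real.log ‖fiberProd α (fun x => Smat (W x)) n x 0 0‖) volume 0 1 := by
      have hci : CircleIntegrable (fun w => Real.log ‖(columnIter F D α n w).1‖) 0 1 :=
        MeromorphicOn.circleIntegrable_log_norm_of_nonneg
          (han.mono sphere_subset_closedBall).meromorphicOn zero_le_one
      refine (intervalIntegrable_exp_of_circleIntegrable hci).congr fun x _ => ?_
      obtain ⟨d, hd, h⟩ := columnIter_exp hW hD α n x
      simp only [h, norm_mul, hd, one_mul, Complex.norm_real]
    calc n * Real.log (z * m) - Real.log 2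
        = Real.log ((z * m) ^ n) - Real.log 2 := by rw [Real.log_pow]
      _ ≤ Real.log ‖(columnIter F D α n 0).1‖ - Real.log 2 := by gcongr
      _ ≤ Real.circleAverage (fun w => Real.log ‖(columnIter F D α n w).1‖) 0 1 - Real.log 2 := by
          gcongr
          exact log_norm_le_circleAverage han (norm_pos_iff.1 (hpos.trans_le hlow))
      _ = ∫ x in (0:ℝ)..1,
            (Real.log ‖fiberProd α (fun x => Smat (W x)) n x 0 0‖ - Real.log 2) := by
          rw [circleAverage_eq_integral_exp, intervalIntegral.integral_sub hint (by simp)]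
          simp only [intervalIntegral.integral_const, sub_zero, one_smul]
          congr 2
          funext x
          obtain ⟨d, hd, h⟩ := columnIter_exp hW hD α n x
          rw [h, norm_mul, hd, one_mul, Complex.norm_real]
      _ ≤ _ := by
          refine intervalIntegral.integral_mono_on zero_le_one (hint.sub (by simp))
            (intervalIntegrable_log_norm_fiberProd α hA hdet n) fun x _ => ?_
          have hhalf := half_le_norm_of_det_eq_one (det_fiberProd α hdet n x)
          rcases eq_or_ne (fiberProd α (fun x => Smat (W x)) n x 0 0) 0 with h0 | h0
          · rw [h0, norm_zero, Real.log_zero, zero_sub, ← Real.log_inv]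
            exact Real.log_le_log (by norm_num) (by linarith)
          · have h1 := Real.log_le_log (norm_pos_iff.2 h0)
              (norm_entry_le_entrywise_sup_norm (fiberProd α (fun x => Smat (W x)) n x))
            linarith [Real.log_nonneg one_le_two]
  have hlim : Filter.Tendsto (fun n : ℕ => Real.log (z * m) - (n : ℝ)⁻¹ * Real.log 2)
      Filter.atTop (nhds (Real.log (z * m))) := by
    simpa using tendsto_const_nhds.sub
      ((tendsto_inv_atTop_nhds_zero_nat (𝕜 := ℝ)).mul_const (Real.log 2))
  rw [← hlim.limsup_eq]
  refine Filter.limsup_le_limsup ?_ hlim.isCoboundedUnder_le hbdd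
  filter_upwards [Filter.eventually_gt_atTop 0] with n hn
  have hn' : (0 : ℝ) < n := by exact_mod_cast hn
  have h := mul_le_mul_of_nonneg_left (key n) (inv_pos.2 hn').le
  rwa [mul_sub, inv_mul_cancel_left₀ hn'.ne'] at h

open Complex in
theorem Vkl_denom_identity {lam z : ℝ} (hz : lam * (1 - z) ^ 2 = z) (x : ℝ) :
    ((1 + 4 * lam * Real.sin (Real.pi * x) ^ 2 : ℝ) : ℂ) * exp (2 * Real.pi * x * I) * z =
      lam * (exp (2 * Real.pi * x * I) - z) * (1 - z * exp (2 * Real.pi * x * I)) := by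
  have hz' : (lam : ℂ) * (1 - z) ^ 2 = z := by exact_mod_cast congrArg ((↑) : ℝ → ℂ) hz
  set u := exp (Real.pi * x * I) with hu
  have hw : exp (2 * Real.pi * x * I) = u ^ 2 := by
    rw [hu, ← exp_nat_mul]
    congr 1
    push_cast
    ring
  have hu0 : u ≠ 0 := exp_ne_zero _
  have hsin : ((Real.sin (Real.pi * x) : ℝ) : ℂ) = (u⁻¹ - u) * I / 2 := by
    rw [ofReal_sin, Complex.sin, hu, ← exp_neg]
    push_cast
    ring_nf
  rw [hw]
  push_cast
  rw [← ofReal_mul, ← ofReal_sin, hsin]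
  have h4 : 4 * ((u⁻¹ - u) * I / 2) ^ 2 * u ^ 2 = -(1 - u ^ 2) ^ 2 := by
    field_simp
    rw [I_sq]
    ring
  linear_combination (lam * z : ℂ) * h4 - u ^ 2 * hz'

theorem norm_sub_ofReal_eq_norm_one_sub_mul {w : ℂ} (hw : ‖w‖ = 1) (z : ℝ) :
    ‖w - z‖ = ‖1 - z * w‖ := by
  have h : w.re * w.re + w.im * w.im = 1 := by
    rw [← Complex.normSq_apply, Complex.normSq_eq_norm_sq, hw, one_pow]
  rw [Complex.norm_def, Complex.norm_def]
  congr 1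
  simp only [Complex.normSq_apply, Complex.sub_re, Complex.sub_im, Complex.ofReal_re,
    Complex.ofReal_im, Complex.one_re, Complex.one_im, Complex.re_ofReal_mul,
    Complex.im_ofReal_mul]
  linear_combination (1 - z ^ 2) * h

open Metric Complex in
theorem log_le_lyap_Vkl {K lam z E m : ℝ} (hK : 0 < K) (hlam : 0 < lam) (hz : 0 < z)
    (hz1 : z < 1) (hlz : lam * (1 - z) ^ 2 = z) (hm : 0 < m) (hE : |E| = m + 1 / m) (α : ℝ) :
    Real.log (z * m) ≤ lyap α (fun x => Smat (E - Vkl K lam x)) := by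
  have hden : ∀ x : ℝ, 1 ≤ 1 + 4 * lam * Real.sin (Real.pi * x) ^ 2 := fun x => by
    have : 0 ≤ 4 * lam * Real.sin (Real.pi * x) ^ 2 := by positivity
    linarith
  have hne : ∀ w ∈ closedBall (0 : ℂ) 1, 1 - z * w ≠ 0 := fun w hw h => by
    have h1 : ‖(z : ℂ) * w‖ = 1 := by rw [← sub_eq_zero.1 h, norm_one]
    rw [norm_mul, Complex.norm_real, Real.norm_of_nonneg hz.le] at h1
    have : ‖w‖ ≤ 1 := by simpa using hw
    nlinarith
  have hcirc : ∀ x : ℝ, ‖exp (2 * Real.pi * x * I)‖ = 1 := fun x => by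
    have := norm_exp_ofReal_mul_I (2 * Real.pi * x)
    push_cast at this
    exact this
  have hmem : ∀ x : ℝ, exp (2 * Real.pi * x * I) ∈ closedBall (0 : ℂ) 1 := fun x => by
    simp [hcirc x]
  have hDa : AnalyticOnNhd ℂ (fun w : ℂ => (w - z) / (1 - z * w)) (closedBall 0 1) :=
    fun w hw => by
      have := hne w hw
      fun_prop (disch := assumption)
  refine log_le_lyap
    (F := fun w => (w - z) / (1 - z * w) * E - K * (1 - z) ^ 2 * w / (1 - z * w) ^ 2)
    (D := fun w => (w - z) / (1 - z * w)) (C := |E| + K) (E := E)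
    ?_ ?_ ?_ hDa ?_ ?_ hz hm hE ?_ ?_ α
  · unfold Vkl
    exact continuous_const.sub (continuous_const.div (by fun_prop) fun x => by linarith [hden x])
  · intro x
    refine (abs_sub _ _).trans ?_
    gcongr
    rw [Vkl, abs_of_nonneg (div_nonneg hK.le (by linarith [hden x]))]
    exact div_le_self hK.le (hden x)
  · intro w hw
    have := hne w hw
    have := pow_ne_zero 2 this
    fun_prop (disch := assumption)
  · intro x
    have hQ := Vkl_denom_identity hlz x
    have hq : ((1 + 4 * lam * Real.sin (Real.pi * x) ^ 2 : ℝ) : ℂ) ≠ 0 :=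
      ofReal_ne_zero.2 (by linarith [hden x])
    have hw := hne _ (hmem x)
    have hlz' : (lam : ℂ) * (1 - z) ^ 2 = z := by exact_mod_cast congrArg ((↑) : ℝ → ℂ) hlz
    have hlam' : (lam : ℂ) ≠ 0 := ofReal_ne_zero.2 hlam.ne'
    rw [Vkl, ofReal_sub, ofReal_div]
    generalize ((1 + 4 * lam * Real.sin (Real.pi * x) ^ 2 : ℝ) : ℂ) = q at *
    generalize exp (2 * Real.pi * x * I) = w at *
    have hmain : (1 - (z : ℂ)) ^ 2 * w * q = (w - z) * (1 - z * w) := by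
      refine mul_left_cancel₀ hlam' ?_
      linear_combination hQ + w * q * hlz'
    generalize 1 - (z : ℂ) * w = b at hw hmain ⊢
    field_simp
    linear_combination -(K : ℂ) * hmain
  · intro x
    rw [norm_div, norm_sub_ofReal_eq_norm_one_sub_mul (hcirc x),
      div_self (norm_ne_zero_iff.2 (hne _ (hmem x)))]
  · simp [abs_of_pos hz]
  · simp

theorem log_explicit_le_lyap_Vkl {K lam E : ℝ} (hK : 0 < K) (hlam : 0 < lam) (hE : 2 < |E|)
    (α : ℝ) :
    Real.log (((2 * lam + 1 - Real.sqrt (4 * lam + 1)) / (2 * lam)) *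
        ((|E| + Real.sqrt (E ^ 2 - 4)) / 2)) ≤
      lyap α (fun x => Smat (E - Vkl K lam x)) := by
  have hs := Real.sq_sqrt (show 0 ≤ 4 * lam + 1 by positivity)
  have hs0 := Real.sqrt_nonneg (4 * lam + 1)
  have hE2 : 4 < E ^ 2 := by
    rw [← sq_abs]
    nlinarith
  have ht := Real.sq_sqrt (show 0 ≤ E ^ 2 - 4 by linarith)
  have ht0 := Real.sqrt_nonneg (E ^ 2 - 4)
  rw [← sq_abs E] at ht ht0 ⊢
  generalize Real.sqrt (4 * lam + 1) = s at *
  generalize Real.sqrt (|E| ^ 2 - 4) = t at *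
  have hs1 : 1 < s := by nlinarith
  have hsub : s < 2 * lam + 1 := by nlinarith
  refine log_le_lyap_Vkl hK hlam (div_pos (by linarith) (by linarith))
    ((div_lt_one (by linarith)).2 (by linarith)) ?_ (by linarith) ?_ α
  · field_simp
    linear_combination hs
  · have hm : |E| + t ≠ 0 := by linarith
    field_simp
    linear_combination -ht

theorem one_lt_explicit {ε lam E : ℝ} (hε : 0 < ε) (hlam : ((2 + ε) / ε) ^ 2 < lam)
    (hE : 2 + ε < |E|) :
    1 < ((2 * lam + 1 - Real.sqrt (4 * lam + 1)) / (2 * lam)) *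
        ((|E| + Real.sqrt (E ^ 2 - 4)) / 2) := by
  have hlam0 : 0 < lam := lt_of_le_of_lt (by positivity) hlam
  have hs := Real.sq_sqrt (show 0 ≤ 4 * lam + 1 by positivity)
  have hsε : 2 * ((2 + ε) / ε) < Real.sqrt (4 * lam + 1) := by
    refine Real.lt_sqrt_of_sq_lt ?_
    rw [mul_pow]
    linarith
  rw [← mul_div_assoc, div_lt_iff₀ hε] at hsε
  have ht0 := Real.sqrt_nonneg (E ^ 2 - 4)
  generalize Real.sqrt (4 * lam + 1) = s at *
  generalize Real.sqrt (E ^ 2 - 4) = t at *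
  have hs1 : 1 < s := by nlinarith
  have hz : 4 * lam < (2 * lam + 1 - s) * (2 + ε) := by nlinarith
  have hpos : 0 < 2 * lam + 1 - s := by
    by_contra! h
    nlinarith
  rw [div_mul_div_comm, one_lt_div (by positivity)]
  nlinarith

/-- For every `ε > 0` there is `λ_pp(ε) > 0` such that for all `λ > λ_pp`, all
irrational `α` and all `|E| > 2 + ε`, `LE(α, S_{E−V_{K,λ}}) > 0`.  Moreover, for all
`λ > 0`, all irrational `α` and all `|E| > 2`,
`LE(α, S_{E−V_{K,λ}}) ≥ log (z₀ (|E| + √(E²−4)) / 2)` with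
`z₀ = (2λ + 1 − √(4λ+1))/(2λ)`. -/
theorem stmt_14 (K : ℝ) (hK : 0 < K) :
    (∀ ε > (0 : ℝ), ∃ lampp > (0 : ℝ), ∀ lam : ℝ, lampp < lam →
      ∀ α : ℝ, Irrational α → ∀ E : ℝ, 2 + ε < |E| →
        0 < lyap α (fun x => Smat (E - Vkl K lam x))) ∧
    (∀ lam : ℝ, 0 < lam → ∀ α : ℝ, Irrational α → ∀ E : ℝ, 2 < |E| →
      Real.log (((2 * lam + 1 - Real.sqrt (4 * lam + 1)) / (2 * lam)) *
          ((|E| + Real.sqrt (E ^ 2 - 4)) / 2)) ≤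
        lyap α (fun x => Smat (E - Vkl K lam x))) := by
  refine ⟨fun ε hε => ⟨((2 + ε) / ε) ^ 2, by positivity, fun lam hlam α _ E hE => ?_⟩,
    fun lam hlam α _ E hE => log_explicit_le_lyap_Vkl hK hlam hE α⟩
  have hlam0 : 0 < lam := lt_of_le_of_lt (by positivity) hlam
  exact (Real.log_pos (one_lt_explicit hε hlam hE)).trans_le
    (log_explicit_le_lyap_Vkl hK hlam0 (by linarith) α)
end

section
/- Let K > 10 and V_{K,λ}(x) = K/(1 + 4λ sin²(πx)). Then for all sufficiently large λ, for all x ∈ 𝕋, all E ∈ [−3/(2K), −1/K], and all α ∈ [1/4, 3/4], the trace of S_{E−V_{K,λ}}(x+α)·S_{E−V_{K,λ}}(x) lies in the interval [−2 + 1/K², 2 − 1/K²]; in particular the matrix S_{E−V_{K,λ}}(x+α)·S_{E−V_{K,λ}}(x) is elliptic for every x ∈ 𝕋. -/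
open Matrix MeasureTheory
open scoped ENNReal

attribute [local instance] Matrix.normedAddCommGroup Matrix.normedSpace

theorem trace_Smat_mul_Smat (a b : ℝ) : (Smat a * Smat b).trace = -2 + a * b := by
  simp [Smat, Matrix.trace_fin_two]
  ring

theorem Vkl_nonneg {K lam : ℝ} (hK : 0 ≤ K) (hlam : 0 ≤ lam) (x : ℝ) : 0 ≤ Vkl K lam x := by
  unfold Vkl
  positivity

theorem Vkl_le {K lam : ℝ} (hK : 0 ≤ K) (hlam : 0 ≤ lam) (x : ℝ) : Vkl K lam x ≤ K :=
  div_le_self hK (le_add_of_nonneg_right (by positivity))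

theorem Vkl_le_one_div {K lam x : ℝ} (hK : 0 < K) (hlam : 2 * K ^ 2 ≤ lam)
    (hx : 1 / 8 ≤ Real.sin (Real.pi * x) ^ 2) : Vkl K lam x ≤ 1 / K := by
  have hlam0 : 0 ≤ lam := le_trans (by positivity) hlam
  have hmul := mul_le_mul_of_nonneg_left hx hlam0
  unfold Vkl
  rw [div_le_div_iff₀ (by positivity) hK]
  nlinarith

/-- The points `x` and `x + α` cannot both be close to `ℤ` when `α` is far from `ℤ`. -/
theorem sin_sq_ge_or_sin_sq_add_ge (x : ℝ) {α : ℝ} (hα : α ∈ Set.Icc (1/4 : ℝ) (3/4)) :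
    1 / 8 ≤ Real.sin (Real.pi * x) ^ 2 ∨ 1 / 8 ≤ Real.sin (Real.pi * (x + α)) ^ 2 := by
  have hpi := Real.pi_pos
  have hcos : Real.cos (2 * (Real.pi * α)) ≤ 0 :=
    Real.cos_nonpos_of_pi_div_two_le_of_le (by nlinarith [hα.1]) (by nlinarith [hα.2])
  have hsin := Real.sin_sq_eq_half_sub (Real.pi * α)
  have hsub : Real.sin (Real.pi * α) =
      Real.sin (Real.pi * (x + α)) * Real.cos (Real.pi * x) -
        Real.cos (Real.pi * (x + α)) * Real.sin (Real.pi * x) := by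
    rw [← Real.sin_sub]
    ring_nf
  set s := Real.sin (Real.pi * x)
  set t := Real.sin (Real.pi * (x + α))
  set c := Real.cos (Real.pi * x)
  set d := Real.cos (Real.pi * (x + α))
  have htc : (t * c) ^ 2 ≤ t ^ 2 := by
    rw [mul_pow]
    exact mul_le_of_le_one_right (sq_nonneg t) (Real.cos_sq_le_one _)
  have hds : (d * s) ^ 2 ≤ s ^ 2 := by
    rw [mul_pow]
    exact mul_le_of_le_one_left (sq_nonneg s) (Real.cos_sq_le_one _)
  rw [hsub] at hsin
  by_contra! h
  nlinarith [h.1, h.2, sq_nonneg (t * c + d * s)]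

/-- For `K > 10` and all `λ` large enough, for all `x ∈ 𝕋`, all
`E ∈ [−3/(2K), −1/K]` and all `α ∈ [1/4, 3/4]`, the trace of
`S_{E−V_{K,λ}}(x+α) S_{E−V_{K,λ}}(x)` lies in `[−2 + 1/K², 2 − 1/K²]`; in particular
this matrix is elliptic. -/
theorem stmt_15 (K : ℝ) (hK : 10 < K) :
    ∃ lam₀ : ℝ, ∀ lam : ℝ, lam₀ < lam →
      ∀ x E α : ℝ, E ∈ Set.Icc (-3 / (2 * K)) (-1 / K) →
        α ∈ Set.Icc (1/4 : ℝ) (3/4) →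
        (Smat (E - Vkl K lam (x + α)) * Smat (E - Vkl K lam x)).trace ∈
          Set.Icc (-2 + 1 / K ^ 2) (2 - 1 / K ^ 2) ∧
        |(Smat (E - Vkl K lam (x + α)) * Smat (E - Vkl K lam x)).trace| < 2 := by
  have hK0 : 0 < K := by linarith
  refine ⟨2 * K ^ 2, fun lam hlam x E α hE hα => ?_⟩
  have hlam0 : 0 ≤ lam := by nlinarith [sq_nonneg K]
  have hu : 0 < 1 / K := by positivity
  have hKu : K * (1 / K) = 1 := by field_simp
  have hu10 : 1 / K < 1 / 10 := one_div_lt_one_div_of_lt (by norm_num) hK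
  have hE1 : -(3 / 2 * (1 / K)) ≤ E := by
    have h : -3 / (2 * K) = -(3 / 2 * (1 / K)) := by field_simp
    exact h ▸ hE.1
  have hE2 : E ≤ -(1 / K) := by simpa only [neg_div] using hE.2
  have hV := Vkl_nonneg hK0.le hlam0 x
  have hV' := Vkl_nonneg hK0.le hlam0 (x + α)
  have hVK := Vkl_le hK0.le hlam0 x
  have hVK' := Vkl_le hK0.le hlam0 (x + α)
  have hsmall : Vkl K lam x ≤ 1 / K ∨ Vkl K lam (x + α) ≤ 1 / K :=
    (sin_sq_ge_or_sin_sq_add_ge x hα).imp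
      (Vkl_le_one_div hK0 hlam.le) (Vkl_le_one_div hK0 hlam.le)
  rw [trace_Smat_mul_Smat, ← _root_.one_div_pow]
  generalize Vkl K lam x = v at *
  generalize Vkl K lam (x + α) = w at *
  generalize 1 / K = u at *
  have hlow : u ^ 2 ≤ (E - w) * (E - v) := by nlinarith
  have hup : (E - w) * (E - v) ≤ 4 - u ^ 2 := by
    have hprod : (E - w) * (E - v) ≤ (5 / 2 * u) * (3 / 2 * u + K) := by
      rw [← neg_mul_neg]
      rcases hsmall with h | h
      · rw [mul_comm]
        exact mul_le_mul (by linarith) (by linarith) (by linarith) (by linarith)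
      · exact mul_le_mul (by linarith) (by linarith) (by linarith) (by linarith)
    nlinarith
  have hu2 : 0 < u ^ 2 := by positivity
  exact ⟨⟨by linarith, by linarith⟩, abs_lt.2 ⟨by linarith, by linarith⟩⟩
end
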